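/- For all μ > 0 and ν ∈ (−l, l) with μ² > ν², the partial derivative of T with respect to ν satisfies |∂T/∂ν (μ,ν)| ≤ M̄ [ π|ν|/√(μ² − ν²) + |ν|/((μ² − ν²)√(1 + μ² − ν²)) + μ/(μ² − ν²) ]. -/

import Mathlib

open MeasureTheory Set

/-- The exit-time function near a saddle point:
`T(μ,ν) = (1/2)∫_ν^l g(√(y² + μ² - ν²), y)/√(y² + μ² - ν²) dy`,
where `g` plays the role of `det J_ψ`. -/
noncomputable def Tfun (g : ℝ × ℝ → ℝ) (l μ ν : ℝ) : ℝ :=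
  (1 / 2) * ∫ y in ν..l,
    g (Real.sqrt (y ^ 2 + μ ^ 2 - ν ^ 2), y) / Real.sqrt (y ^ 2 + μ ^ 2 - ν ^ 2)

open Topology in
/-- Leibniz rule for an integral whose left endpoint is the parameter. -/
theorem hasDerivAt_integral_left_endpoint {F F' : ℝ → ℝ → ℝ} {x₀ b C : ℝ} {s : Set ℝ}
    (hs : s ∈ 𝓝 x₀) (hF : ∀ x ∈ s, Continuous (F x))
    (hF₀ : ContinuousAt (Function.uncurry F) (x₀, x₀)) (hF' : Continuous (F' x₀))
    (hC : ∀ x ∈ s, ∀ y, ‖F' x y‖ ≤ C)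
    (hderiv : ∀ x ∈ s, ∀ y, HasDerivAt (fun x => F x y) (F' x y) x) :
    HasDerivAt (fun x => ∫ y in x..b, F x y) ((∫ y in x₀..b, F' x₀ y) - F x₀ x₀) x₀ := by
  have h_fixed : HasDerivAt (fun x => ∫ y in x₀..b, F x y) (∫ y in x₀..b, F' x₀ y) x₀ :=
    (intervalIntegral.hasDerivAt_integral_of_dominated_loc_of_deriv_le hs
      (by filter_upwards [hs] with x hx using (hF x hx).aestronglyMeasurable)
      ((hF x₀ (mem_of_mem_nhds hs)).intervalIntegrable _ _)
      hF'.aestronglyMeasurable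
      (.of_forall fun y _ x hx => hC x hx y)
      (_root_.intervalIntegrable_const (c := C))
      (.of_forall fun y _ x hx => hderiv x hx y)).2
  have h_moving : HasDerivAt (fun x => ∫ y in x₀..x, F x y) (F x₀ x₀) x₀ := by
    rw [hasDerivAt_iff_isLittleO, Asymptotics.isLittleO_iff]
    intro ε hε
    obtain ⟨δ, hδ, hδF⟩ := Metric.continuousAt_iff.1 hF₀ ε hε
    filter_upwards [hs, Metric.ball_mem_nhds x₀ hδ] with x hx hxδ
    have h_eq : (∫ y in x₀..x, F x y) - (∫ y in x₀..x₀, F x₀ y) - (x - x₀) • F x₀ x₀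
        = ∫ y in x₀..x, (F x y - F x₀ x₀) := by
      rw [intervalIntegral.integral_sub ((hF x hx).intervalIntegrable _ _)
        _root_.intervalIntegrable_const]
      simp
    rw [h_eq]
    refine intervalIntegral.norm_integral_le_of_norm_le_const fun y hy => ?_
    have hy' : dist y x₀ ≤ dist x x₀ := by
      rw [Real.dist_eq, Real.dist_eq]
      exact abs_sub_left_of_mem_uIcc (uIoc_subset_uIcc hy)
    have hlt : dist (x, y) (x₀, x₀) < δ := by
      rw [Prod.dist_eq]
      exact max_lt hxδ (hy'.trans_lt hxδ)
    exact (dist_eq_norm (F x y) (F x₀ x₀)).symm.le.trans (hδF hlt).le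
  refine (h_fixed.sub h_moving).congr_of_eventuallyEq ?_
  filter_upwards [hs] with x hx
  exact (intervalIntegral.integral_interval_sub_left ((hF x hx).intervalIntegrable _ _)
    ((hF x hx).intervalIntegrable _ _)).symm

/-- The derivative in `x` of `g (√(y ^ 2 + m ^ 2 - x ^ 2), y) / √(y ^ 2 + m ^ 2 - x ^ 2)`. -/
noncomputable def radialQuotientDeriv (g : ℝ × ℝ → ℝ) (m x y : ℝ) : ℝ :=
  x * (g (√(y ^ 2 + m ^ 2 - x ^ 2), y) / √(y ^ 2 + m ^ 2 - x ^ 2) ^ 3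
    - fderiv ℝ g (√(y ^ 2 + m ^ 2 - x ^ 2), y) (1, 0) / √(y ^ 2 + m ^ 2 - x ^ 2) ^ 2)

theorem hasDerivAt_radialQuotient {g : ℝ × ℝ → ℝ} (hg : Differentiable ℝ g) {m x y : ℝ}
    (h : 0 < y ^ 2 + m ^ 2 - x ^ 2) :
    HasDerivAt (fun x => g (√(y ^ 2 + m ^ 2 - x ^ 2), y) / √(y ^ 2 + m ^ 2 - x ^ 2))
      (radialQuotientDeriv g m x y) x := by
  have hr : 0 < √(y ^ 2 + m ^ 2 - x ^ 2) := Real.sqrt_pos.2 h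
  have hsqrt : HasDerivAt (fun x => √(y ^ 2 + m ^ 2 - x ^ 2))
      (-x / √(y ^ 2 + m ^ 2 - x ^ 2)) x := by
    have h1 := (((hasDerivAt_id x).pow 2).const_sub (y ^ 2 + m ^ 2)).sqrt h.ne'
    refine h1.congr_deriv ?_
    simp only [id, Pi.pow_apply]
    field_simp
    norm_num
  have hcomp := (hg (√(y ^ 2 + m ^ 2 - x ^ 2), y)).hasFDerivAt.comp_hasDerivAt x
    (hsqrt.prodMk (hasDerivAt_const x y))
  refine (hcomp.div hsqrt hr.ne').congr_deriv ?_
  have hlin (c : ℝ) : ((c, 0) : ℝ × ℝ) = c • (1, 0) := by simp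
  rw [hlin, map_smul, smul_eq_mul, radialQuotientDeriv]
  simp only [Function.comp_apply]
  field_simp
  ring

theorem abs_fderiv_one_zero_le {g : ℝ × ℝ → ℝ} {M : ℝ} {p : ℝ × ℝ}
    (h : ‖fderiv ℝ g p‖ ≤ M) : |fderiv ℝ g p (1, 0)| ≤ M := by
  have h1 := (fderiv ℝ g p).le_opNorm (1, 0)
  rw [Prod.norm_mk, norm_one, norm_zero, max_eq_left zero_le_one, mul_one] at h1
  exact h1.trans h

theorem abs_radialQuotientDeriv_le {g : ℝ × ℝ → ℝ} {M : ℝ}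
    (hgb : ∀ p, |g p| ≤ M) (hgd : ∀ p, ‖fderiv ℝ g p‖ ≤ M) (m x y : ℝ) :
    |radialQuotientDeriv g m x y| ≤ |x| * M *
      (1 / √(y ^ 2 + m ^ 2 - x ^ 2) ^ 3 + 1 / √(y ^ 2 + m ^ 2 - x ^ 2) ^ 2) := by
  rw [radialQuotientDeriv, abs_mul, mul_assoc]
  set r := √(y ^ 2 + m ^ 2 - x ^ 2)
  have hr : 0 ≤ r := Real.sqrt_nonneg _
  refine mul_le_mul_of_nonneg_left ((abs_sub _ _).trans ?_) (abs_nonneg x)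
  rw [abs_div, abs_div, abs_of_nonneg (pow_nonneg hr 3), abs_of_nonneg (pow_nonneg hr 2),
    mul_add, mul_one_div, mul_one_div]
  gcongr
  · exact hgb _
  · exact abs_fderiv_one_zero_le (hgd _)

theorem continuous_radialQuotientDeriv {g : ℝ × ℝ → ℝ} (hg : ContDiff ℝ 1 g) {m x : ℝ}
    (h : x ^ 2 < m ^ 2) : Continuous (radialQuotientDeriv g m x) := by
  have hpos (y : ℝ) : √(y ^ 2 + m ^ 2 - x ^ 2) ≠ 0 :=
    (Real.sqrt_pos.2 (by nlinarith [sq_nonneg y])).ne'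
  have hg0 := hg.continuous
  have hg1 := hg.continuous_fderiv one_ne_zero
  unfold radialQuotientDeriv
  refine continuous_const.mul (Continuous.sub ?_ ?_)
  · exact (hg0.comp (by fun_prop)).div (by fun_prop) fun y => pow_ne_zero _ (hpos y)
  · exact ((hg1.comp (by fun_prop : Continuous fun y : ℝ =>
      (√(y ^ 2 + m ^ 2 - x ^ 2), y))).clm_apply continuous_const).div (by fun_prop)
      fun y => pow_ne_zero _ (hpos y)

open Topology in
theorem hasDerivAt_Tfun {l M : ℝ} {g : ℝ × ℝ → ℝ} (hg : ContDiff ℝ 1 g)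
    (hgb : ∀ p, |g p| ≤ M) (hgd : ∀ p, ‖fderiv ℝ g p‖ ≤ M) {μ ν : ℝ} (hμ : 0 < μ)
    (hμν : ν ^ 2 < μ ^ 2) :
    HasDerivAt (fun ν' => Tfun g l μ ν')
      ((1 / 2) * ((∫ y in ν..l, radialQuotientDeriv g μ ν y) - g (μ, ν) / μ)) ν := by
  have hM : 0 ≤ M := (abs_nonneg _).trans (hgb 0)
  set c := (μ ^ 2 - ν ^ 2) / 2 with hc
  have hc0 : 0 < c := by linarith
  have hg0 := hg.continuous
  let s : Set ℝ := {x | x ^ 2 < μ ^ 2 - c}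
  have hs : s ∈ 𝓝 ν := (isOpen_lt (by fun_prop) (by fun_prop)).mem_nhds
    (show ν ^ 2 < μ ^ 2 - c by linarith)
  have hpos {x : ℝ} (hx : x ∈ s) (y : ℝ) : c ≤ y ^ 2 + μ ^ 2 - x ^ 2 := by
    have : x ^ 2 < μ ^ 2 - c := hx
    nlinarith [sq_nonneg y]
  have hdiag : √(ν ^ 2 + μ ^ 2 - ν ^ 2) = μ := by
    rw [add_sub_cancel_left, Real.sqrt_sq hμ.le]
  have key := hasDerivAt_integral_left_endpoint (b := l) (x₀ := ν)
    (F := fun x y => g (√(y ^ 2 + μ ^ 2 - x ^ 2), y) / √(y ^ 2 + μ ^ 2 - x ^ 2))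
    (F' := radialQuotientDeriv g μ) (C := μ * M * (1 / √c ^ 3 + 1 / √c ^ 2)) hs
    (fun x hx => (hg0.comp (by fun_prop)).div (by fun_prop) fun y =>
      (Real.sqrt_pos.2 (hc0.trans_le (hpos hx y))).ne')
    (by
      refine ContinuousAt.div (Continuous.continuousAt ?_) (Continuous.continuousAt ?_) ?_
      · exact hg0.comp (by fun_prop)
      · fun_prop
      · simpa only [hdiag] using hμ.ne')
    (continuous_radialQuotientDeriv hg hμν)
    (fun x hx y => by
      have hsc : 0 < √c := Real.sqrt_pos.2 hc0
      have hle : √c ≤ √(y ^ 2 + μ ^ 2 - x ^ 2) := Real.sqrt_le_sqrt (hpos hx y)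
      have hxμ : |x| ≤ μ := by
        have hxs : x ^ 2 < μ ^ 2 - c := hx
        exact abs_le_of_sq_le_sq (by linarith) hμ.le
      refine (abs_radialQuotientDeriv_le hgb hgd μ x y).trans ?_
      gcongr)
    (fun x hx y => hasDerivAt_radialQuotient (hg.differentiable one_ne_zero)
      (hc0.trans_le (hpos hx y)))
  simp only [hdiag] at key
  exact key.const_mul (1 / 2)

theorem integral_inv_sq_add_le_pi_div_sqrt {a x y : ℝ} (ha : 0 < a) :
    ∫ t in x..y, 1 / (t ^ 2 + a) ≤ Real.pi / √a := by
  have hs : 0 < √a := Real.sqrt_pos.2 ha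
  have h := integral_inv_sq_add_sq (a := x) (b := y) hs.ne'
  simp only [Real.sq_sqrt ha.le, add_comm a] at h
  simp only [one_div, h]
  rw [div_eq_inv_mul Real.pi]
  have h1 := Real.arctan_lt_pi_div_two (y / √a)
  have h2 := Real.neg_pi_div_two_lt_arctan (x / √a)
  exact mul_le_mul_of_nonneg_left (by linarith) (inv_nonneg.2 hs.le)

theorem integral_one_div_sqrt_cube {a x y : ℝ} (ha : 0 < a) :
    ∫ t in x..y, 1 / √(t ^ 2 + a) ^ 3 = y / (a * √(y ^ 2 + a)) - x / (a * √(x ^ 2 + a)) := by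
  have hpos (t : ℝ) : 0 < t ^ 2 + a := by positivity
  have hs (t : ℝ) : 0 < √(t ^ 2 + a) := Real.sqrt_pos.2 (hpos t)
  refine intervalIntegral.integral_eq_sub_of_hasDerivAt
    (f := fun t => t / (a * √(t ^ 2 + a))) (fun t _ => ?_) ?_
  · have hsq : √(t ^ 2 + a) ^ 2 = t ^ 2 + a := Real.sq_sqrt (hpos t).le
    have h1 := (((hasDerivAt_id t).pow 2).add_const a).sqrt (hpos t).ne'
    have h2 := (hasDerivAt_id t).div (h1.const_mul a) (mul_pos ha (hs t)).ne'
    refine h2.congr_deriv ?_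
    have := hs t
    simp only [id, Pi.pow_apply]
    field_simp
    norm_num
    linarith
  · exact (continuous_const.div (by fun_prop)
      fun t => pow_ne_zero 3 (hs t).ne').intervalIntegrable _ _

/-- `t ↦ t / √(t ^ 2 + a)` at `t ∈ [0, 1]` is bounded by its value at `1`. -/
theorem div_sqrt_sq_add_le {a t : ℝ} (ha : 0 < a) (ht0 : 0 ≤ t) (ht1 : t ≤ 1) :
    t / √(t ^ 2 + a) ≤ 1 / √(1 + a) := by
  rw [div_le_div_iff₀ (Real.sqrt_pos.2 (by positivity)) (Real.sqrt_pos.2 (by positivity)), one_mul]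
  refine Real.le_sqrt_of_sq_le ?_
  rw [mul_pow, Real.sq_sqrt (by positivity)]
  nlinarith [mul_nonneg ha.le (sub_nonneg.2 (pow_le_one₀ ht0 ht1 : t ^ 2 ≤ 1))]

/-- estimate \eqref{derv2}. Fix `l ∈ (0,1)`, `M̄ > 0`, and a
`C¹` function `g` with `|g| ≤ M̄` and `|∇g| ≤ M̄`.  For all `μ > 0`,
`ν ∈ (-l, l)` with `μ² > ν²`:
`|∂T/∂ν(μ,ν)| ≤ M̄[π|ν|/√(μ²-ν²) + |ν|/((μ²-ν²)√(1+μ²-ν²)) + μ/(μ²-ν²)]`. -/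
theorem Tfun_deriv_nu_bound
    (l M : ℝ) (hl0 : 0 < l) (hl1 : l < 1) (hM : 0 < M)
    (g : ℝ × ℝ → ℝ) (hg : ContDiff ℝ 1 g)
    (hgb : ∀ p, |g p| ≤ M) (hgd : ∀ p, ‖fderiv ℝ g p‖ ≤ M)
    (μ ν : ℝ) (hμ : 0 < μ) (hν : ν ∈ Set.Ioo (-l) l) (hμν : ν ^ 2 < μ ^ 2) :
    ∃ D : ℝ, HasDerivAt (fun ν' => Tfun g l μ ν') D ν ∧
      |D| ≤ M * (Real.pi * |ν| / Real.sqrt (μ ^ 2 - ν ^ 2) +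
        |ν| / ((μ ^ 2 - ν ^ 2) * Real.sqrt (1 + μ ^ 2 - ν ^ 2)) +
        μ / (μ ^ 2 - ν ^ 2)) := by
  obtain ⟨hν1, hν2⟩ := hν
  refine ⟨_, hasDerivAt_Tfun hg hgb hgd hμ hμν, ?_⟩
  set a := μ ^ 2 - ν ^ 2 with ha
  have ha0 : 0 < a := by linarith
  have hpos (y : ℝ) : 0 < y ^ 2 + a := by positivity
  have hbound (y : ℝ) : |radialQuotientDeriv g μ ν y| ≤
      |ν| * M * (1 / √(y ^ 2 + a) ^ 3 + 1 / (y ^ 2 + a)) := by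
    have h := abs_radialQuotientDeriv_le hgb hgd μ ν y
    rwa [add_sub_assoc, ← ha, Real.sq_sqrt (hpos y).le] at h
  have hint3 : IntervalIntegrable (fun y => 1 / √(y ^ 2 + a) ^ 3) volume ν l :=
    (continuous_const.div (by fun_prop)
      fun y => pow_ne_zero 3 (Real.sqrt_pos.2 (hpos y)).ne').intervalIntegrable _ _
  have hint2 : IntervalIntegrable (fun y => 1 / (y ^ 2 + a)) volume ν l :=
    (continuous_const.div (by fun_prop) fun y => (hpos y).ne').intervalIntegrable _ _
  have hI : |∫ y in ν..l, radialQuotientDeriv g μ ν y| ≤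
      |ν| * M * (1 / (a * √(1 + a)) + |ν| / (a * μ) + Real.pi / √a) := by
    refine (intervalIntegral.norm_integral_le_of_norm_le hν2.le
      (.of_forall fun y _ => (Real.norm_eq_abs _).le.trans (hbound y)) ((hint3.add hint2).const_mul _)).trans ?_
    rw [intervalIntegral.integral_const_mul, intervalIntegral.integral_add hint3 hint2,
      integral_one_div_sqrt_cube ha0]
    have hνμ : √(ν ^ 2 + a) = μ := by rw [ha, add_sub_cancel, Real.sqrt_sq hμ.le]
    have hl : l / (a * √(l ^ 2 + a)) ≤ 1 / (a * √(1 + a)) := by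
      have h := div_le_div_of_nonneg_right (div_sqrt_sq_add_le ha0 hl0.le hl1.le) ha0.le
      rwa [div_div, div_div, mul_comm _ a, mul_comm _ a] at h
    have hν' : -(ν / (a * μ)) ≤ |ν| / (a * μ) := by
      rw [← neg_div]
      gcongr
      exact neg_le_abs ν
    rw [hνμ]
    refine mul_le_mul_of_nonneg_left ?_ (by positivity)
    linarith [integral_inv_sq_add_le_pi_div_sqrt (x := ν) (y := l) ha0]
  have hend : |g (μ, ν) / μ| ≤ M / μ := by
    rw [abs_div, abs_of_pos hμ]
    gcongr
    exact hgb _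
  have hsum : |ν| * (|ν| / (a * μ)) + 1 / μ = μ / a := by
    have := sq_abs ν
    field_simp
    linarith
  rw [add_sub_assoc, ← ha, abs_mul, abs_of_pos (by norm_num : (0 : ℝ) < 1 / 2)]
  have htotal := (abs_sub _ _).trans (add_le_add hI hend)
  have hrhs : |ν| * M * (1 / (a * √(1 + a)) + |ν| / (a * μ) + Real.pi / √a) + M / μ =
      M * (Real.pi * |ν| / √a + |ν| / (a * √(1 + a)) + μ / a) := by
    rw [← hsum]
    ring
  rw [hrhs] at htotal
  have hnn : 0 ≤ M * (Real.pi * |ν| / √a + |ν| / (a * √(1 + a)) + μ / a) := by positivity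
  linarith
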